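/- Let n ≥ 1 and let A, B be finite subsets of ℝ^n (objective vectors, all objectives minimized) with A nonempty. If every point of B is weakly dominated by some point of A, then the contribution of A on B satisfies 1/2 ≤ C(A, B) ≤ 1. -/

import Mathlib

/-- `z` dominates `z'` (all objectives minimized). -/
def Dominates {n : ℕ} (z z' : Fin n → ℝ) : Prop :=
  (∀ i : Fin n, z i ≤ z' i) ∧ ∃ j : Fin n, z j < z' j

/-- The non-dominated front of a finite set `S` of objective vectors. -/
noncomputable def front {n : ℕ} (S : Finset (Fin n → ℝ)) : Finset (Fin n → ℝ) :=
  @Finset.filter _ (fun z => ∀ z' ∈ S, ¬ Dominates z' z) (Classical.decPred _) S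

/-- The contribution of `A` on `B`: the proportion of the non-dominated front of `A ∪ B`
represented by `A`, points common to both sets counting one half. -/
noncomputable def contribution {n : ℕ} (A B : Finset (Fin n → ℝ)) : ℚ :=
  (((A ∩ B ∩ front (A ∪ B)).card : ℚ) / 2 + (((A \ B) ∩ front (A ∪ B)).card : ℚ))
    / ((front (A ∪ B)).card : ℚ)

/-- If every point of `B` is weakly dominated by some point of `A`, then the contribution
of `A` on `B` lies in the interval `[1/2, 1]`. -/
theorem contribution_mem_Icc_of_weakly_dominates (n : ℕ) (hn : 1 ≤ n)
    (A B : Finset (Fin n → ℝ)) (hA : A.Nonempty)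
    (hwd : ∀ b ∈ B, ∃ a ∈ A, ∀ i : Fin n, a i ≤ b i) :
    1 / 2 ≤ contribution A B ∧ contribution A B ≤ 1 := by
  have hmem : ∀ z, z ∈ front (A ∪ B) ↔ z ∈ A ∪ B ∧ ∀ z' ∈ A ∪ B, ¬ Dominates z' z := by
    intro z
    unfold front
    exact @Finset.mem_filter _ _ (Classical.decPred _) _ _
  have hsub : ∀ z ∈ front (A ∪ B), z ∈ A := by
    intro z hz
    obtain ⟨hz1, hz2⟩ := (hmem z).1 hz
    rcases Finset.mem_union.1 hz1 with h | h
    · exact h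
    · obtain ⟨a, ha, hle⟩ := hwd z h
      have hnd := hz2 a (Finset.mem_union_left _ ha)
      have haz : a = z := by
        funext i
        by_contra hne
        exact hnd ⟨hle, i, lt_of_le_of_ne (hle i) hne⟩
      exact haz ▸ ha
  have hne : (front (A ∪ B)).Nonempty := by
    obtain ⟨m, hm⟩ := Finset.exists_minimal (s := A ∪ B) (hA.mono Finset.subset_union_left)
    refine ⟨m, (hmem m).2 ⟨hm.1, ?_⟩⟩
    rintro z hz ⟨hle, j, hj⟩
    exact absurd (hm.2 hz hle j) (not_le.2 hj)
  have hcard : (A ∩ B ∩ front (A ∪ B)).card + ((A \ B) ∩ front (A ∪ B)).card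
      = (front (A ∪ B)).card := by
    rw [← Finset.card_union_of_disjoint]
    · congr 1
      ext z
      have := hsub z
      simp only [Finset.mem_union, Finset.mem_inter, Finset.mem_sdiff]
      tauto
    · rw [Finset.disjoint_left]
      intro z h1 h2
      simp only [Finset.mem_inter, Finset.mem_sdiff] at h1 h2
      exact h2.1.2 h1.1.2
  have hpos : (0 : ℚ) < ((front (A ∪ B)).card : ℚ) := by
    exact_mod_cast hne.card_pos
  have hq : ((A ∩ B ∩ front (A ∪ B)).card : ℚ) + (((A \ B) ∩ front (A ∪ B)).card : ℚ)
      = ((front (A ∪ B)).card : ℚ) := by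
    exact_mod_cast hcard
  have h1 : (0 : ℚ) ≤ ((A ∩ B ∩ front (A ∪ B)).card : ℚ) := Nat.cast_nonneg _
  have h2 : (0 : ℚ) ≤ (((A \ B) ∩ front (A ∪ B)).card : ℚ) := Nat.cast_nonneg _
  unfold contribution
  constructor
  · rw [le_div_iff₀ hpos]
    linarith
  · rw [div_le_one hpos]
    linarith
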